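/- arXiv:2401.01992 — 4 statements merged into one kernel-verified Lean document; each statement's English description precedes it below -/
import Mathlib

section
/- Let n ≥ 3 and let χ and γ be symmetric n×n real matrices with γ positive definite. If for all indices i, j, k, ℓ ∈ {1,…,n} one has χ_{ik}γ_{jℓ} + χ_{jℓ}γ_{ik} − χ_{iℓ}γ_{jk} − χ_{jk}γ_{iℓ} = 0, then χ = 0. -/
/-- Contracting the symmetry relation with a two-sided inverse `G` of `γ`. -/
theorem contract_symmetry_relation {ι R : Type*} [Fintype ι] [DecidableEq ι] [CommRing R]
    {χ γ G : Matrix ι ι R} (hl : G * γ = 1) (hr : γ * G = 1)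
    (h : ∀ i j k l : ι,
      χ i k * γ j l + χ j l * γ i k - χ i l * γ j k - χ j k * γ i l = 0) :
    ((Fintype.card ι : R) - 2) • χ + (G * χ).trace • γ = 0 := by
  ext i k
  have key : ∑ l, ∑ j, G l j *
      (χ i k * γ j l + χ j l * γ i k - χ i l * γ j k - χ j k * γ i l) = 0 := by
    simp [h]
  have h₁ : ∑ l, ∑ j, χ i k * (G l j * γ j l) = χ i k * Fintype.card ι := by
    simp_rw [← Finset.mul_sum]
    rw [← Matrix.trace_one (n := ι) (R := R), ← hl]
    rfl
  have h₂ : ∑ l, ∑ j, (G l j * χ j l) * γ i k = (G * χ).trace * γ i k := by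
    simp_rw [← Finset.sum_mul]
    rfl
  have h₃ : ∑ l, ∑ j, χ i l * (G l j * γ j k) = χ i k := by
    simp_rw [← Finset.mul_sum, ← Matrix.mul_apply, hl, Matrix.mul_one]
  have h₄ : ∑ l, ∑ j, γ i l * (G l j * χ j k) = χ i k := by
    simp_rw [← Finset.mul_sum, ← Matrix.mul_apply, ← Matrix.mul_assoc, hr, Matrix.one_mul]
  have expand : ∑ l, ∑ j, G l j *
      (χ i k * γ j l + χ j l * γ i k - χ i l * γ j k - χ j k * γ i l) =
      (∑ l, ∑ j, χ i k * (G l j * γ j l)) + (∑ l, ∑ j, (G l j * χ j l) * γ i k) -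
        (∑ l, ∑ j, χ i l * (G l j * γ j k)) - ∑ l, ∑ j, γ i l * (G l j * χ j k) := by
    simp_rw [← Finset.sum_add_distrib, ← Finset.sum_sub_distrib]
    refine Finset.sum_congr rfl fun l _ => Finset.sum_congr rfl fun j _ => ?_
    ring
  rw [key, h₁, h₂, h₃, h₄] at expand
  simp only [Matrix.add_apply, Matrix.smul_apply, smul_eq_mul, Matrix.zero_apply]
  linear_combination -expand

/-- If `n ≥ 3`, `χ` and `γ` are symmetric real `n × n` matrices, `γ` is positive
definite, and `χ_{ik}γ_{jℓ} + χ_{jℓ}γ_{ik} − χ_{iℓ}γ_{jk} − χ_{jk}γ_{iℓ} = 0` for all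
indices, then `χ = 0`. -/
theorem chi_eq_zero_of_symmetry_relation (n : ℕ) (hn : 3 ≤ n)
    (χ γ : Matrix (Fin n) (Fin n) ℝ)
    (hχ : χ.IsSymm) (hγsymm : γ.IsSymm) (hγ : γ.PosDef)
    (h : ∀ i j k l : Fin n,
      χ i k * γ j l + χ j l * γ i k - χ i l * γ j k - χ j k * γ i l = 0) :
    χ = 0 := by
  have hdet : IsUnit γ.det := (Matrix.isUnit_iff_isUnit_det γ).mp hγ.isUnit
  have hl := Matrix.nonsing_inv_mul γ hdet
  have contracted := contract_symmetry_relation hl (Matrix.mul_nonsing_inv γ hdet) h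
  have hn' : (3 : ℝ) ≤ n := by exact_mod_cast hn
  have traced := congrArg (fun A => (γ⁻¹ * A).trace) contracted
  simp only [Matrix.mul_add, Matrix.mul_smul, Matrix.trace_add, Matrix.trace_smul, hl,
    Matrix.trace_one, Matrix.mul_zero, Matrix.trace_zero, Fintype.card_fin, smul_eq_mul] at traced
  have trace_zero : (γ⁻¹ * χ).trace = 0 := by
    have hmul : (2 * (n : ℝ) - 2) * (γ⁻¹ * χ).trace = 0 := by linear_combination traced
    exact (mul_eq_zero.mp hmul).resolve_left (by linarith)
  rw [trace_zero, zero_smul, add_zero, Fintype.card_fin] at contracted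
  exact (smul_eq_zero.mp contracted).resolve_left (by linarith)
end

section
/- Let n ≥ 2 and K ∈ ℝ. Let ψ₁, …, ψₙ : ℝ → ℝ be twice differentiable functions such that Σⱼ ψⱼ(yⱼ) ≠ 0 for every y = (y₁,…,yₙ) ∈ ℝⁿ, and such that for every y ∈ ℝⁿ and every k ∈ {1,…,n}: 2·(Σⱼ ψⱼ(yⱼ))·ψₖ''(yₖ) = K + Σⱼ (ψⱼ'(yⱼ))². Then there exist real numbers α and p₁,…,pₙ, q₁,…,qₙ such that ψₖ(s) = α s² + pₖ s + qₖ for all s ∈ ℝ and every k, and moreover 4α·(Σₖ qₖ) − Σₖ pₖ² = K. In particular, all ψₖ are quadratic polynomials with the same leading coefficient α, and when α ≠ 0 each ψₖ can be written as ψₖ(s) = (A/4)(s − cₖ)² + bₖ with A = 4α and A·(Σₖ bₖ) = K. -/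
/-- A differentiable function on `ℝ` with constant derivative is affine. -/
theorem eq_mul_add_of_deriv_eq_const {f : ℝ → ℝ} {a : ℝ} (hf : Differentiable ℝ f)
    (h : ∀ s, deriv f s = a) (s : ℝ) : f s = a * s + f 0 := by
  have hg (x : ℝ) : HasDerivAt (fun t => f t - a * t) 0 x := by
    have h1 := (hf x).hasDerivAt.sub ((hasDerivAt_id x).const_mul a)
    rw [h x, mul_one, sub_self] at h1
    exact h1
  have := is_const_of_deriv_eq_zero (fun x => (hg x).differentiableAt) (fun x => (hg x).deriv) s 0
  linarith

/-- A twice differentiable function on `ℝ` with constant second derivative is quadratic. -/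
theorem eq_quadratic_of_deriv_deriv_eq_const {f : ℝ → ℝ} {a : ℝ} (hf : Differentiable ℝ f)
    (hf' : Differentiable ℝ (deriv f)) (h : ∀ s, deriv (deriv f) s = a) (s : ℝ) :
    f s = a / 2 * s ^ 2 + deriv f 0 * s + f 0 := by
  have hg (x : ℝ) : HasDerivAt (fun t => f t - a / 2 * t ^ 2) (deriv f 0) x := by
    have h1 := (hf x).hasDerivAt.sub ((hasDerivAt_pow 2 x).const_mul (a / 2))
    refine h1.congr_deriv ?_
    rw [eq_mul_add_of_deriv_eq_const hf' h x]
    push_cast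
    ring
  have := eq_mul_add_of_deriv_eq_const (fun x => (hg x).differentiableAt)
    (fun x => (hg x).deriv) s
  linarith

/-- If the values `g k (y k)` do not depend on `k`, whatever `y` is, and there are at least two
indices, then all the functions `g k` equal one common constant. -/
theorem exists_forall_eq_of_forall_apply_eq {ι α β : Type*} [Nontrivial ι] [Nonempty α]
    {g : ι → α → β} (h : ∀ (y : ι → α) (k l : ι), g k (y k) = g l (y l)) :
    ∃ a, ∀ k s, g k s = a := by
  classical
  obtain ⟨i⟩ := (inferInstance : Nonempty ι)
  obtain ⟨x⟩ := (inferInstance : Nonempty α)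
  refine ⟨g i x, fun k s => ?_⟩
  obtain ⟨l, hl⟩ := exists_ne k
  have h1 := h (Function.update (fun _ => x) k s) k l
  rw [Function.update_self, Function.update_of_ne hl] at h1
  exact h1.trans (h (fun _ => x) l i)


/-- Classification of the over-determined system `2(Σⱼψⱼ)ψₖ'' = K + Σⱼ(ψⱼ')²`:
each `ψₖ` is a quadratic polynomial with common leading coefficient `α`, subject to
the compatibility constraint `4α(Σₖqₖ) − Σₖpₖ² = K`; in particular, when `α ≠ 0`,
`ψₖ(s) = (A/4)(s − cₖ)² + bₖ` with `A = 4α` and `A·(Σₖbₖ) = K`. -/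
theorem quadratic_classification_of_overdetermined_system
    (n : ℕ) (hn : 2 ≤ n) (K : ℝ) (ψ : Fin n → ℝ → ℝ)
    (hψ : ∀ k, Differentiable ℝ (ψ k))
    (hψ' : ∀ k, Differentiable ℝ (deriv (ψ k)))
    (hne : ∀ y : Fin n → ℝ, (∑ j, ψ j (y j)) ≠ 0)
    (heq : ∀ (y : Fin n → ℝ) (k : Fin n),
      2 * (∑ j, ψ j (y j)) * deriv (deriv (ψ k)) (y k)
        = K + ∑ j, (deriv (ψ j) (y j)) ^ 2) :
    ∃ (α : ℝ) (p q : Fin n → ℝ),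
      (∀ (k : Fin n) (s : ℝ), ψ k s = α * s ^ 2 + p k * s + q k) ∧
      (4 * α * (∑ k, q k) - ∑ k, (p k) ^ 2 = K) ∧
      (α ≠ 0 → ∃ (c b : Fin n → ℝ),
        (∀ (k : Fin n) (s : ℝ), ψ k s = (4 * α) / 4 * (s - c k) ^ 2 + b k) ∧
        (4 * α) * (∑ k, b k) = K) := by
  have : Nontrivial (Fin n) := Fin.nontrivial_iff_two_le.2 hn
  obtain ⟨a, ha⟩ := exists_forall_eq_of_forall_apply_eq
    (g := fun k => deriv (deriv (ψ k))) fun y k l =>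
      mul_left_cancel₀ (mul_ne_zero two_ne_zero (hne y)) ((heq y k).trans (heq y l).symm)
  have hquad (k : Fin n) (s : ℝ) :
      ψ k s = a / 2 * s ^ 2 + deriv (ψ k) 0 * s + ψ k 0 :=
    eq_quadratic_of_deriv_deriv_eq_const (hψ k) (hψ' k) (ha k) s
  have hK : 4 * (a / 2) * (∑ k, ψ k 0) - ∑ k, (deriv (ψ k) 0) ^ 2 = K := by
    have h0 := heq (fun _ => 0) ⟨0, by omega⟩
    rw [ha] at h0
    linarith
  refine ⟨a / 2, fun k => deriv (ψ k) 0, fun k => ψ k 0, hquad, hK, fun hα => ?_⟩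
  have ha0 : a ≠ 0 := fun h => hα (by rw [h, zero_div])
  refine ⟨fun k => -(deriv (ψ k) 0 / a), fun k => ψ k 0 - (deriv (ψ k) 0) ^ 2 / (2 * a),
    fun k s => ?_, ?_⟩
  · rw [hquad k s]
    field_simp
    ring
  · rw [Finset.sum_sub_distrib, ← Finset.sum_div, ← hK]
    field_simp
    ring
end

section
/- Let n ≥ 1 and let f : ℝⁿ → ℝ be a C² function such that all mixed second partial derivatives vanish identically: ∂²f/∂yᵢ∂yⱼ (y) = 0 for all y ∈ ℝⁿ and all i ≠ j. Then there exist C² functions g₁, …, gₙ : ℝ → ℝ such that f(y₁,…,yₙ) = g₁(y₁) + ⋯ + gₙ(yₙ) for all y ∈ ℝⁿ. -/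
theorem eq_of_fderiv_apply_sub_eq_zero {E : Type*} [NormedAddCommGroup E] [NormedSpace ℝ E]
    {φ : E → ℝ} (hφ : Differentiable ℝ φ) {x y : E}
    (h : ∀ z, fderiv ℝ φ z (y - x) = 0) : φ y = φ x := by
  have hd : ∀ t : ℝ, HasDerivAt (fun t : ℝ => φ (x + t • (y - x))) 0 t := by
    intro t
    have h1 : HasDerivAt (fun t : ℝ => x + t • (y - x)) (y - x) t := by
      simpa using ((hasDerivAt_id t).smul_const (y - x)).const_add x
    have h2 := (hφ (x + t • (y - x))).hasFDerivAt.comp_hasDerivAt t h1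
    rwa [h] at h2
  have hc := is_const_of_deriv_eq_zero (fun t => (hd t).differentiableAt)
    (fun t => (hd t).deriv) 1 0
  simpa using hc

theorem eq_apply_single_of_partial_eq_zero {n : ℕ} {φ : (Fin n → ℝ) → ℝ}
    (hφ : Differentiable ℝ φ) (i : Fin n)
    (h : ∀ z j, i ≠ j → fderiv ℝ φ z (Pi.single j 1) = 0) (y : Fin n → ℝ) :
    φ y = φ (Pi.single i (y i)) := by
  refine eq_of_fderiv_apply_sub_eq_zero hφ fun z => ?_
  have hs := LinearMap.pi_apply_eq_sum_univ (fderiv ℝ φ z).toLinearMap (y - Pi.single i (y i))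
  simp only [ContinuousLinearMap.coe_coe] at hs
  rw [hs]
  refine Finset.sum_eq_zero fun j _ => ?_
  by_cases hij : i = j
  · subst hij
    simp
  · have hj : (fun k => if j = k then (1 : ℝ) else 0) = Pi.single j 1 := by
      ext k
      simp [Pi.single_apply, eq_comm]
    rw [hj, h z j hij, smul_zero]

/-- A `C²` function on `ℝⁿ` whose mixed second partial derivatives vanish identically
is additively separable: `f(y₁,…,yₙ) = g₁(y₁) + ⋯ + gₙ(yₙ)` for `C²` functions `gₖ`. -/
theorem additive_separability_of_vanishing_mixed_partials
    (n : ℕ) (hn : 1 ≤ n) (f : (Fin n → ℝ) → ℝ) (hf : ContDiff ℝ 2 f)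
    (hmix : ∀ (y : Fin n → ℝ) (i j : Fin n), i ≠ j →
      fderiv ℝ (fun z => fderiv ℝ f z (Pi.single i 1)) y (Pi.single j 1) = 0) :
    ∃ g : Fin n → ℝ → ℝ, (∀ k, ContDiff ℝ 2 (g k)) ∧
      ∀ y : Fin n → ℝ, f y = ∑ k, g k (y k) := by
  have hfd : Differentiable ℝ f := hf.differentiable (by norm_num)
  have hpartial : ∀ (i : Fin n) (y : Fin n → ℝ),
      fderiv ℝ f y (Pi.single i 1) = fderiv ℝ f (Pi.single i (y i)) (Pi.single i 1) := by
    intro i y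
    have hf' : Differentiable ℝ (fderiv ℝ f) :=
      (hf.fderiv_right (m := 1) (by norm_num)).differentiable (by norm_num)
    exact eq_apply_single_of_partial_eq_zero (φ := fun z => fderiv ℝ f z (Pi.single i 1))
      (hf'.clm_apply (differentiable_const _)) i (fun z j hij => hmix z i j hij) y
  let F : (Fin n → ℝ) → ℝ := fun y => f y - ∑ k, f (Pi.single k (y k))
  let s : Fin n → ℝ →L[ℝ] (Fin n → ℝ) := fun k => ContinuousLinearMap.single ℝ (fun _ => ℝ) k
  have hF : ∀ y, HasFDerivAt F (fderiv ℝ f y - ∑ k, (fderiv ℝ f (Pi.single k (y k))).comp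
      ((s k).comp (ContinuousLinearMap.proj k))) y := by
    intro y
    refine (hfd y).hasFDerivAt.sub (HasFDerivAt.fun_sum fun k _ => ?_)
    have hk : HasFDerivAt (fun z : Fin n → ℝ => (Pi.single k (z k) : Fin n → ℝ))
        ((s k).comp (ContinuousLinearMap.proj k)) y :=
      ((s k).comp (ContinuousLinearMap.proj (R := ℝ) (φ := fun _ : Fin n => ℝ) k)).hasFDerivAt
    exact HasFDerivAt.comp y (hfd (Pi.single k (y k))).hasFDerivAt hk
  have hF0 : ∀ y, fderiv ℝ F y = 0 := by
    intro y
    rw [(hF y).fderiv]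
    refine ContinuousLinearMap.coe_injective (LinearMap.pi_ext' fun i => LinearMap.ext_ring ?_)
    have hsum : ∑ k, fderiv ℝ f (Pi.single k (y k))
        (Pi.single k ((Pi.single i 1 : Fin n → ℝ) k)) =
        fderiv ℝ f (Pi.single i (y i)) (Pi.single i 1) := by
      rw [Finset.sum_eq_single i]
      · simp
      · intro k _ hk
        simp [Pi.single_eq_of_ne hk]
      · simp
    simp [s, hsum, ← hpartial i y]
  have hconst : ∀ y, F y = F 0 :=
    fun y => is_const_of_fderiv_eq_zero (fun y => (hF y).differentiableAt) hF0 y 0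
  refine ⟨fun k t => f (Pi.single k t) + F 0 / n, fun k => ?_, fun y => ?_⟩
  · exact (hf.comp (s k).contDiff).add contDiff_const
  · have hn0 : (n : ℝ) ≠ 0 := by positivity
    rw [Finset.sum_add_distrib, Finset.sum_const, Finset.card_univ, Fintype.card_fin,
      nsmul_eq_mul, mul_div_cancel₀ _ hn0, ← hconst y]
    simp [F]
end

section
/- Let H be a nonzero real number, let Σ be a 3×3 real symmetric matrix with tr(Σ) = 0, and define the 3×3 matrix θ := H(I + √6 Σ). Let μ denote the uniform probability measure on the unit sphere S² = {x ∈ ℝ³ : ‖x‖ = 1}. Then: (i) ∫_{S²} ⟨x, θx⟩ dμ(x) = H; and (ii) the variance σ_A² := ∫_{S²} ⟨x, θx⟩² dμ(x) − H² satisfies σ_A² = (4/5)·H²·tr(Σ²), equivalently √(tr(Σ²)) = (√5/2)·σ_A/|H| where σ_A := √(σ_A²). -/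
open MeasureTheory

section SphereMoments

variable {μ : Measure (EuclideanSpace ℝ (Fin 3))}

/-- A continuous function is integrable for a finite measure carried by the unit sphere. -/
lemma integrable_of_ae_norm_eq_one [IsFiniteMeasure μ] (hsupp : ∀ᵐ x ∂μ, ‖x‖ = 1)
    {f : EuclideanSpace ℝ (Fin 3) → ℝ} (hf : Continuous f) : Integrable f μ := by
  have hr : μ.restrict (Metric.sphere 0 1) = μ :=
    Measure.restrict_eq_self_of_ae_mem (by simpa using hsupp)
  have h : IntegrableOn f (Metric.sphere 0 1) μ :=
    hf.continuousOn.integrableOn_compact (isCompact_sphere 0 1)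
  rwa [IntegrableOn, hr] at h

/-- Invariance of the integral under the hyperplane reflection
`x ↦ x - (2 ⟪v, x⟫ / ‖v‖²) v`. -/
lemma integral_comp_reflection
    (hinv : ∀ O : EuclideanSpace ℝ (Fin 3) ≃ₗᵢ[ℝ] EuclideanSpace ℝ (Fin 3),
      Measure.map (⇑O) μ = μ)
    (v : EuclideanSpace ℝ (Fin 3)) (f : EuclideanSpace ℝ (Fin 3) → ℝ) :
    ∫ x, f (x - (2 * (inner ℝ v x / ‖v‖ ^ 2)) • v) ∂μ = ∫ x, f x ∂μ := by
  set O := (ℝ ∙ v)ᗮ.reflection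
  have hO (x : EuclideanSpace ℝ (Fin 3)) :
      x - (2 * (inner ℝ v x / ‖v‖ ^ 2)) • v = O x := by
    simp [O, Submodule.reflection_orthogonal_apply, Submodule.reflection_singleton_apply,
      mul_smul, two_smul]
  simp_rw [hO]
  conv_rhs => rw [← hinv O]
  exact (integral_map_equiv O.toHomeomorph.toMeasurableEquiv f).symm

/-- A function that is odd in one coordinate has integral zero. -/
lemma integral_eq_zero_of_odd
    (hinv : ∀ O : EuclideanSpace ℝ (Fin 3) ≃ₗᵢ[ℝ] EuclideanSpace ℝ (Fin 3),
      Measure.map (⇑O) μ = μ)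
    (i : Fin 3) {f : EuclideanSpace ℝ (Fin 3) → ℝ}
    (hf : ∀ x, f (x - (2 * x i) • EuclideanSpace.single i 1) = -f x) :
    ∫ x, f x ∂μ = 0 := by
  have h := integral_comp_reflection hinv (EuclideanSpace.single i 1) f
  simp only [EuclideanSpace.inner_single_left, map_one, one_mul, PiLp.norm_single, norm_one,
    one_pow, div_one, hf, integral_neg] at h
  linarith

/-- Invariance of the integral under permuting the coordinates. -/
lemma integral_comp_perm
    (hinv : ∀ O : EuclideanSpace ℝ (Fin 3) ≃ₗᵢ[ℝ] EuclideanSpace ℝ (Fin 3),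
      Measure.map (⇑O) μ = μ)
    (e : Equiv.Perm (Fin 3)) (f : EuclideanSpace ℝ (Fin 3) → ℝ) :
    ∫ x, f (WithLp.toLp 2 fun i => x (e i)) ∂μ = ∫ x, f x ∂μ := by
  set O := LinearIsometryEquiv.piLpCongrLeft 2 ℝ ℝ e.symm
  have hO (x : EuclideanSpace ℝ (Fin 3)) : WithLp.toLp 2 (fun i => x (e i)) = O x := by
    ext i
    simp [O, LinearIsometryEquiv.piLpCongrLeft_apply]
  simp_rw [hO]
  conv_rhs => rw [← hinv O]
  exact (integral_map_equiv O.toHomeomorph.toMeasurableEquiv f).symm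

lemma integral_coord_mul_of_ne
    (hinv : ∀ O : EuclideanSpace ℝ (Fin 3) ≃ₗᵢ[ℝ] EuclideanSpace ℝ (Fin 3),
      Measure.map (⇑O) μ = μ)
    {i j : Fin 3} (hj : j ≠ i) : ∫ x, x i * x j ∂μ = 0 :=
  integral_eq_zero_of_odd hinv i fun x => by simp [hj]; ring

lemma integral_coord_mul_four_of_ne
    (hinv : ∀ O : EuclideanSpace ℝ (Fin 3) ≃ₗᵢ[ℝ] EuclideanSpace ℝ (Fin 3),
      Measure.map (⇑O) μ = μ)
    {i j k l : Fin 3} (hj : j ≠ i) (hk : k ≠ i) (hl : l ≠ i) :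
    ∫ x, x i * x j * (x k * x l) ∂μ = 0 :=
  integral_eq_zero_of_odd hinv i fun x => by simp [hj, hk, hl]; ring

lemma integral_coord_sq [IsProbabilityMeasure μ] (hsupp : ∀ᵐ x ∂μ, ‖x‖ = 1)
    (hinv : ∀ O : EuclideanSpace ℝ (Fin 3) ≃ₗᵢ[ℝ] EuclideanSpace ℝ (Fin 3),
      Measure.map (⇑O) μ = μ)
    (i : Fin 3) : ∫ x, x i ^ 2 ∂μ = 1 / 3 := by
  have hi (j : Fin 3) : ∫ x, x j ^ 2 ∂μ = ∫ x, x i ^ 2 ∂μ := by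
    simpa using integral_comp_perm hinv (Equiv.swap i j) fun x => x i ^ 2
  have hsum : ∫ x, ∑ j, x j ^ 2 ∂μ = 1 := by
    rw [integral_congr_ae (g := fun _ => 1)]
    · simp
    · filter_upwards [hsupp] with x hx
      simpa [hx] using (EuclideanSpace.real_norm_sq_eq x).symm
  rw [integral_finsetSum _ fun j _ => integrable_of_ae_norm_eq_one hsupp (by fun_prop)] at hsum
  simp only [hi, Finset.sum_const, Finset.card_univ, Fintype.card_fin, nsmul_eq_mul] at hsum
  push_cast at hsum
  linarith

/-- The moments `∫ xᵢ⁴` and `∫ xᵢ² xⱼ²` of the uniform measure on `S²`. -/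
lemma integral_coord_sq_mul_sq [IsProbabilityMeasure μ] (hsupp : ∀ᵐ x ∂μ, ‖x‖ = 1)
    (hinv : ∀ O : EuclideanSpace ℝ (Fin 3) ≃ₗᵢ[ℝ] EuclideanSpace ℝ (Fin 3),
      Measure.map (⇑O) μ = μ)
    (i j : Fin 3) : ∫ x, x i ^ 2 * x j ^ 2 ∂μ = if i = j then 1 / 5 else 1 / 15 := by
  have hcont {f : EuclideanSpace ℝ (Fin 3) → ℝ} (hf : Continuous f) : Integrable f μ :=
    integrable_of_ae_norm_eq_one hsupp hf
  have hperm (e : Equiv.Perm (Fin 3)) (k l : Fin 3) :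
      ∫ x, x (e k) ^ 2 * x (e l) ^ 2 ∂μ = ∫ x, x k ^ 2 * x l ^ 2 ∂μ :=
    integral_comp_perm hinv e fun x => x k ^ 2 * x l ^ 2
  set a := ∫ x, x 0 ^ 2 * x 0 ^ 2 ∂μ with ha
  set b := ∫ x, x 0 ^ 2 * x 1 ^ 2 ∂μ with hb
  have hdiag (k : Fin 3) : ∫ x, x k ^ 2 * x k ^ 2 ∂μ = a := by
    simpa using hperm (Equiv.swap 0 k) 0 0
  have hoff (k l : Fin 3) (hkl : k ≠ l) : ∫ x, x k ^ 2 * x l ^ 2 ∂μ = b := by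
    obtain ⟨e, he0, he1⟩ : ∃ e : Equiv.Perm (Fin 3), e 0 = k ∧ e 1 = l := by
      revert k l; decide
    rw [← he0, ← he1, hperm]
  have hsum : a + 2 * b = 1 / 3 := by
    have h : ∫ x, ∑ k, x 0 ^ 2 * x k ^ 2 ∂μ = 1 / 3 := by
      rw [← integral_coord_sq hsupp hinv 0]
      refine integral_congr_ae ?_
      filter_upwards [hsupp] with x hx
      rw [← Finset.mul_sum, ← EuclideanSpace.real_norm_sq_eq, hx]
      ring
    rw [integral_finsetSum _ fun k _ => hcont (by fun_prop), Fin.sum_univ_three,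
      hdiag, hoff 0 1 (by decide), hoff 0 2 (by decide)] at h
    linarith
  -- The reflection in `(2, 1, 0)` maps the first coordinate to `-(3 x₀ + 4 x₁) / 5`.
  have hrot : 625 * a = 337 * a + 864 * b := by
    have h := integral_comp_reflection hinv !₂[2, 1, 0] fun x => 625 * x 0 ^ 4
    have h1 : ∫ x, 625 * x 0 ^ 4 ∂μ = 625 * a := by
      rw [ha, ← integral_const_mul]
      congr with x
      ring
    have h2 (x : EuclideanSpace ℝ (Fin 3)) :
        625 * (x - (2 * (inner ℝ !₂[(2 : ℝ), 1, 0] x / ‖!₂[(2 : ℝ), 1, 0]‖ ^ 2)) •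
          !₂[(2 : ℝ), 1, 0]) 0 ^ 4 =
        81 * (x 0 ^ 2 * x 0 ^ 2) + 256 * (x 1 ^ 2 * x 1 ^ 2) + 864 * (x 0 ^ 2 * x 1 ^ 2)
          + 432 * (x 1 * x 0 * (x 0 * x 0)) + 768 * (x 0 * x 1 * (x 1 * x 1)) := by
      simp [EuclideanSpace.real_norm_sq_eq, Fin.sum_univ_three, PiLp.inner_apply]
      ring
    simp_rw [h2] at h
    rw [h1, integral_add (hcont (by fun_prop)) (hcont (by fun_prop)),
      integral_add (hcont (by fun_prop)) (hcont (by fun_prop)),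
      integral_add (hcont (by fun_prop)) (hcont (by fun_prop)),
      integral_add (hcont (by fun_prop)) (hcont (by fun_prop))] at h
    simp only [integral_const_mul] at h
    rw [hdiag 1, integral_coord_mul_four_of_ne hinv (by decide) (by decide) (by decide),
      integral_coord_mul_four_of_ne hinv (by decide) (by decide) (by decide)] at h
    linarith
  split_ifs with hij
  · rw [← hij, hdiag]
    linarith
  · rw [hoff i j hij]
    linarith

lemma integral_coord_mul [IsProbabilityMeasure μ] (hsupp : ∀ᵐ x ∂μ, ‖x‖ = 1)
    (hinv : ∀ O : EuclideanSpace ℝ (Fin 3) ≃ₗᵢ[ℝ] EuclideanSpace ℝ (Fin 3),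
      Measure.map (⇑O) μ = μ)
    (i j : Fin 3) : ∫ x, x i * x j ∂μ = (1 : Matrix (Fin 3) (Fin 3) ℝ) i j / 3 := by
  rcases eq_or_ne i j with rfl | h
  · simpa [sq] using integral_coord_sq hsupp hinv i
  · simp [h, integral_coord_mul_of_ne hinv h.symm]

/-- The fourth moment tensor of the uniform measure on `S²`. -/
lemma integral_coord_mul_four [IsProbabilityMeasure μ] (hsupp : ∀ᵐ x ∂μ, ‖x‖ = 1)
    (hinv : ∀ O : EuclideanSpace ℝ (Fin 3) ≃ₗᵢ[ℝ] EuclideanSpace ℝ (Fin 3),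
      Measure.map (⇑O) μ = μ)
    (i j k l : Fin 3) :
    ∫ x, x i * x j * (x k * x l) ∂μ =
      ((if i = j then if k = l then 1 else 0 else 0) +
        (if i = k then if j = l then 1 else 0 else 0) +
        (if i = l then if j = k then 1 else 0 else 0)) / 15 := by
  have hsq (p q : Fin 3) : ∫ x, x p * x p * (x q * x q) ∂μ = if p = q then 1 / 5 else 1 / 15 := by
    simpa [sq] using integral_coord_sq_mul_sq hsupp hinv p q
  have hpair (p q r : Fin 3) : ∫ x, x p * x p * (x q * x r) ∂μ =
      if q = r then if p = q then 1 / 5 else 1 / 15 else 0 := by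
    split_ifs with hqr hpq
    · rw [← hqr, hsq, if_pos hpq]
    · rw [← hqr, hsq, if_neg hpq]
    · by_cases hr : r = p
      · rw [← integral_coord_mul_four_of_ne hinv (i := q) (j := r) (k := p) (l := p)
          (by grind) (by grind) (by grind)]
        congr with x
        ring
      · rw [← integral_coord_mul_four_of_ne hinv (i := r) (j := q) (k := p) (l := p)
          (by grind) (by grind) (by grind)]
        congr with x
        ring
  rcases eq_or_ne i j with rfl | hij
  · rw [hpair]
    split_ifs <;> grind
  rcases eq_or_ne i k with rfl | hik
  · have h : ∫ x, x i * x j * (x i * x l) ∂μ = ∫ x, x i * x i * (x j * x l) ∂μ := by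
      congr with x
      ring
    rw [h, hpair]
    split_ifs <;> grind
  rcases eq_or_ne i l with rfl | hil
  · have h : ∫ x, x i * x j * (x k * x i) ∂μ = ∫ x, x i * x i * (x j * x k) ∂μ := by
      congr with x
      ring
    rw [h, hpair]
    split_ifs <;> grind
  simp [integral_coord_mul_four_of_ne hinv hij.symm hik.symm hil.symm, hij, hik, hil]

/-- The mean of a quadratic form over `S²`. -/
lemma integral_quadraticForm [IsProbabilityMeasure μ] (hsupp : ∀ᵐ x ∂μ, ‖x‖ = 1)
    (hinv : ∀ O : EuclideanSpace ℝ (Fin 3) ≃ₗᵢ[ℝ] EuclideanSpace ℝ (Fin 3),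
      Measure.map (⇑O) μ = μ)
    (A : Matrix (Fin 3) (Fin 3) ℝ) :
    ∫ x, ∑ i, ∑ j, A i j * x i * x j ∂μ = A.trace / 3 := by
  have hcont (f : EuclideanSpace ℝ (Fin 3) → ℝ) (hf : Continuous f) : Integrable f μ :=
    integrable_of_ae_norm_eq_one hsupp hf
  simp_rw [← Fintype.sum_prod_type', mul_assoc]
  rw [integral_finsetSum _ fun p _ => hcont _ (by fun_prop)]
  simp_rw [integral_const_mul, integral_coord_mul hsupp hinv, Fintype.sum_prod_type]
  simp [Matrix.one_apply, Matrix.trace, div_eq_mul_inv, Finset.sum_mul]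

/-- The mean square of a quadratic form over `S²`. -/
lemma integral_quadraticForm_sq [IsProbabilityMeasure μ] (hsupp : ∀ᵐ x ∂μ, ‖x‖ = 1)
    (hinv : ∀ O : EuclideanSpace ℝ (Fin 3) ≃ₗᵢ[ℝ] EuclideanSpace ℝ (Fin 3),
      Measure.map (⇑O) μ = μ)
    {A : Matrix (Fin 3) (Fin 3) ℝ} (hA : A.IsSymm) :
    ∫ x, (∑ i, ∑ j, A i j * x i * x j) ^ 2 ∂μ =
      (A.trace ^ 2 + 2 * (A * A).trace) / 15 := by
  have hcont (f : EuclideanSpace ℝ (Fin 3) → ℝ) (hf : Continuous f) : Integrable f μ :=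
    integrable_of_ae_norm_eq_one hsupp hf
  have hexp (x : EuclideanSpace ℝ (Fin 3)) : (∑ i, ∑ j, A i j * x i * x j) ^ 2 =
      ∑ p : (Fin 3 × Fin 3) × Fin 3 × Fin 3, A p.1.1 p.1.2 * A p.2.1 p.2.2 *
        (x p.1.1 * x p.1.2 * (x p.2.1 * x p.2.2)) := by
    rw [sq, ← Fintype.sum_prod_type', Fintype.sum_mul_sum, ← Fintype.sum_prod_type']
    refine Finset.sum_congr rfl fun p _ => ?_
    ring
  simp_rw [hexp]
  rw [integral_finsetSum _ fun p _ => hcont _ (by fun_prop)]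
  simp_rw [integral_const_mul, integral_coord_mul_four hsupp hinv, Fintype.sum_prod_type,
    mul_div_assoc', ← Finset.sum_div, mul_add, Finset.sum_add_distrib]
  simp only [mul_ite, mul_one, mul_zero, Finset.sum_ite_eq, Finset.mem_univ, if_true,
    Matrix.trace, Matrix.diag, Matrix.mul_apply, Fin.sum_univ_three, hA.apply 0 1,
    hA.apply 0 2, hA.apply 1 2, Fin.isValue, Fin.reduceEq, reduceIte]
  ring

end SphereMoments

/-- For the expansion tensor `θ = H(I + √6 Σ)` in spacetime dimension 4 (`Σ` symmetric
and traceless, `H ≠ 0`) and the rotation-invariant probability measure `μ` on the unit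
sphere `S² ⊆ ℝ³`: (i) the directional average of `⟨x, θx⟩` is `H`; (ii) the directional
variance `σ_A² = ∫⟨x,θx⟩² dμ − H²` equals `(4/5)H²·tr(Σ²)`, equivalently
`√(tr Σ²) = (√5/2)·σ_A/|H|`. -/
theorem hubble_anisotropy_standard_deviation
    (μ : Measure (EuclideanSpace ℝ (Fin 3))) [IsProbabilityMeasure μ]
    (hsupp : ∀ᵐ x ∂μ, ‖x‖ = 1)
    (hinv : ∀ O : EuclideanSpace ℝ (Fin 3) ≃ₗᵢ[ℝ] EuclideanSpace ℝ (Fin 3),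
      Measure.map (⇑O) μ = μ)
    (H : ℝ) (hH : H ≠ 0)
    (S : Matrix (Fin 3) (Fin 3) ℝ) (hS : S.IsSymm) (htr : S.trace = 0)
    (θ : Matrix (Fin 3) (Fin 3) ℝ) (hθ : θ = H • (1 + Real.sqrt 6 • S))
    (σA2 : ℝ)
    (hσ : σA2 = (∫ x, (∑ i, ∑ j, θ i j * x i * x j) ^ 2 ∂μ) - H ^ 2) :
    (∫ x, (∑ i, ∑ j, θ i j * x i * x j) ∂μ = H) ∧
    σA2 = 4 / 5 * H ^ 2 * (S * S).trace ∧
    Real.sqrt ((S * S).trace) = Real.sqrt 5 / 2 * Real.sqrt σA2 / |H| := by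
  have htr2 : 0 ≤ (S * S).trace := by
    have h := Matrix.posSemidef_conjTranspose_mul_self S
    rw [Matrix.conjTranspose_eq_transpose_of_trivial, hS.eq] at h
    exact h.trace_nonneg
  have h6 : Real.sqrt 6 * Real.sqrt 6 = 6 := Real.mul_self_sqrt (by norm_num)
  have hθs : θ.IsSymm := by
    rw [hθ]
    exact (Matrix.isSymm_one.add (hS.smul _)).smul _
  have hθtr : θ.trace = 3 * H := by
    simp [hθ, htr, mul_comm]
  have hθtr2 : (θ * θ).trace = H ^ 2 * (3 + 6 * (S * S).trace) := by
    simp [hθ, mul_add, add_mul, smul_smul, htr]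
    linear_combination H ^ 2 * (S * S).trace * h6
  have hvar : σA2 = 4 / 5 * H ^ 2 * (S * S).trace := by
    rw [hσ, integral_quadraticForm_sq hsupp hinv hθs, hθtr, hθtr2]
    ring
  refine ⟨?_, hvar, ?_⟩
  · rw [integral_quadraticForm hsupp hinv, hθtr]
    ring
  · rw [eq_div_iff (abs_ne_zero.mpr hH), ← Real.sqrt_sq_eq_abs, ← Real.sqrt_mul htr2,
      div_mul_eq_mul_div, ← Real.sqrt_mul (by norm_num), hvar, eq_div_iff two_ne_zero,
      show 5 * (4 / 5 * H ^ 2 * (S * S).trace) = (S * S).trace * H ^ 2 * 2 ^ 2 by ring,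
      Real.sqrt_mul (by positivity) (2 ^ 2), Real.sqrt_sq zero_le_two]
end
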